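/- Under condition [A], the Cramér condition [C₀] holds for ξ1 = (τ1, ζ1) and ξ = (τ, ζ): for every δ < ρ/2 one has E e^{δ|ξ1|} ≤ E e^{2δτ1} < ∞ and E e^{δ|ξ|} ≤ E e^{2δτ} < ∞, where ρ := (1/v) ln(1/(1 − (1−δ1)^{v−1} δ2)) and |·| denotes the norm of the vector in ℝ². -/

import Mathlib

noncomputable section

/-- A chain with unbounded variable length memory over the binary alphabet `{0,1}`,
with memory parameter `v ≥ 1`.  For `k ∈ ℕ ∪ {0}` (the distance from the current
position to the nearest `1`) and a word `w` of `v - 1` letters (the letters standing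
to the left of that `1`), `p k w` is the probability of appending the character `1`.
The structure records the sample space, the appended characters `X n = r_n(n)`,
the full configuration `cfg`, the position `mpos ω n` of the rightmost `1` among the
coordinates `≤ n`, and the Markov transition rule `htrans`. -/
structure VLMC (v : ℕ) (p : ℕ → (Fin (v - 1) → Bool) → ℝ) where
  /-- the sample space -/
  Ω : Type
  [mΩ : MeasurableSpace Ω]
  /-- the underlying probability measure -/
  P : MeasureTheory.Measure Ω
  hprob : MeasureTheory.IsProbabilityMeasure P
  hv : 0 < v
  /-- the (fixed) initial configuration; only the coordinates `i ≤ 0` are relevant -/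
  r0 : ℤ → Bool
  /-- `X n` is the random character appended at step `n`, for `n ≥ 1` -/
  X : ℕ → Ω → Bool
  hXmeas : ∀ n, Measurable (X n)
  /-- the full configuration (it does not change in time: at time `n` only the
  coordinates `≤ n` are relevant) -/
  cfg : Ω → ℤ → Bool
  hcfg : ∀ ω i, cfg ω i = if i ≤ 0 then r0 i else X i.toNat ω
  /-- `mpos ω n` is the position of the rightmost `1` among the coordinates `≤ n` -/
  mpos : Ω → ℕ → ℤ
  hmpos : ∀ ω n, mpos ω n ≤ (n : ℤ) ∧ cfg ω (mpos ω n) = true ∧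
    ∀ i : ℤ, mpos ω n < i → i ≤ (n : ℤ) → cfg ω i = false
  /-- the transition rule: on any cylinder (in the appended characters) on which the
  distance from `n` to the nearest `1` equals `k` and the word of the `v - 1` letters
  standing to the left of that `1` equals `w`, the conditional probability that the
  character appended at step `n + 1` equals `1` is `p k w`. -/
  htrans : ∀ (n : ℕ) (b : Fin n → Bool) (k : ℕ) (w : Fin (v - 1) → Bool),
    (∀ ω, (∀ i : Fin n, X (i.1 + 1) ω = b i) →
      ((n : ℤ) - mpos ω n = (k : ℤ) ∧
        ∀ j : Fin (v - 1), cfg ω (mpos ω n - ((v : ℤ) - 1) + (j.1 : ℤ)) = w j)) →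
    P {ω | (∀ i : Fin n, X (i.1 + 1) ω = b i) ∧ X (n + 1) ω = true}
      = ENNReal.ofReal (p k w) * P {ω | ∀ i : Fin n, X (i.1 + 1) ω = b i}

open MeasureTheory Filter

namespace VLMC

variable {v : ℕ} {p : ℕ → (Fin (v - 1) → Bool) → ℝ}

/-- Condition [A]: the initial configuration contains at least one `1`, and all the
transition probabilities lie between `δ2` and `δ1`, where `0 < δ2 < δ1 < 1`. -/
def CondA (S : VLMC v p) (δ1 δ2 : ℝ) : Prop :=
  (∃ i : ℤ, i ≤ 0 ∧ S.r0 i = true) ∧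
  0 < δ2 ∧ δ2 < δ1 ∧ δ1 < 1 ∧
  ∀ (k : ℕ) (w : Fin (v - 1) → Bool), δ2 ≤ p k w ∧ p k w ≤ δ1

/-- `R n`, the number of `1`s appended during the first `n` steps -/
def R (S : VLMC v p) (n : ℕ) (ω : S.Ω) : ℕ :=
  ∑ k ∈ Finset.Icc 1 n, (S.X k ω).toNat

/-- `Y(n) = y₀ = (0,(0,…,0,1))`, i.e. the character at position `n` is `1` and the
`v - 1` letters to its left are all `0` -/
def hitY0 (S : VLMC v p) (ω : S.Ω) (n : ℕ) : Prop :=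
  S.mpos ω n = (n : ℤ) ∧
    ∀ j : Fin (v - 1), S.cfg ω ((n : ℤ) - ((v : ℤ) - 1) + (j.1 : ℤ)) = false

/-- `T k`, the time of the `k`-th visit of the chain `Y` to the state `y₀`
(`T 0 = 0`) -/
def T (S : VLMC v p) : ℕ → S.Ω → ℕ
  | 0, _ => 0
  | k + 1, ω => sInf {n | T S k ω < n ∧ S.hitY0 ω n}

/-- `τ_k = T_k - T_{k-1}`, the spacings between consecutive visits to `y₀` -/
def tau (S : VLMC v p) (k : ℕ) (ω : S.Ω) : ℕ := S.T k ω - S.T (k - 1) ω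

/-- `ζ_k`, the number of `1`s appended at the times `n ∈ (T_{k-1}, T_k]` -/
def zeta (S : VLMC v p) (k : ℕ) (ω : S.Ω) : ℕ :=
  ∑ n ∈ Finset.Ioc (S.T (k - 1) ω) (S.T k ω), (S.X n ω).toNat

/-- `ν(n) = max {k ≥ 0 : T_k < n}` -/
def nu (S : VLMC v p) (n : ℕ) (ω : S.Ω) : ℕ := sSup {k | S.T k ω < n}

/-- the generalized renewal process `Z(n) = Σ_{k=0}^{ν(n)} ζ_k` (with `ζ_0 = 0`) -/
def Z (S : VLMC v p) (n : ℕ) (ω : S.Ω) : ℕ :=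
  ∑ k ∈ Finset.range (S.nu n ω + 1), S.zeta k ω

/-- `a = E ζ / E τ`, where `(τ, ζ) = (τ_2, ζ_2)` has the common distribution of the
regeneration vectors `ξ_k = (τ_k, ζ_k)`, `k ≥ 2` -/
def a (S : VLMC v p) : ℝ :=
  (∫ ω, (S.zeta 2 ω : ℝ) ∂S.P) / (∫ ω, (S.tau 2 ω : ℝ) ∂S.P)

/-- `σ² = E (ζ - aτ)² / E τ` -/
def sigma2 (S : VLMC v p) : ℝ :=
  (∫ ω, ((S.zeta 2 ω : ℝ) - S.a * (S.tau 2 ω : ℝ)) ^ 2 ∂S.P) /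
    (∫ ω, (S.tau 2 ω : ℝ) ∂S.P)

/-- `ψ(λ,μ) = E e^{λτ + μζ}` (as an extended nonnegative real number) -/
def psi (S : VLMC v p) (l m : ℝ) : ENNReal :=
  ∫⁻ ω, ENNReal.ofReal (Real.exp (l * S.tau 2 ω + m * S.zeta 2 ω)) ∂S.P

/-- `ψ₁(λ,μ) = E e^{λτ₁ + μζ₁}` -/
def psi1 (S : VLMC v p) (l m : ℝ) : ℝ :=
  ∫ ω, Real.exp (l * S.tau 1 ω + m * S.zeta 1 ω) ∂S.P

/-- the deviation function `D(θ,α) = sup {λθ + μα : A(λ,μ) ≤ 0}` where `A = ln ψ`,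
so that `A(λ,μ) ≤ 0 ↔ ψ(λ,μ) ≤ 1` -/
def D2 (S : VLMC v p) (θ α : ℝ) : ℝ :=
  sSup {x | ∃ l m : ℝ, S.psi l m ≤ 1 ∧ x = l * θ + m * α}

/-- `D(α) = D(1,α)` -/
def D (S : VLMC v p) (α : ℝ) : ℝ := S.D2 1 α

/-- the chain starts from the state `y₀ = (0,(0,…,0,1))`, i.e. `Y(0) = y₀`: the
initial configuration has a `1` at position `0` preceded by `v - 1` zeros -/
def StartsAtY0 (S : VLMC v p) : Prop :=
  S.r0 0 = true ∧ ∀ i : ℤ, 1 - (v : ℤ) ≤ i → i < 0 → S.r0 i = false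

end VLMC

namespace VLMC

variable {v : ℕ} {p : ℕ → (Fin (v - 1) → Bool) → ℝ}

attribute [local instance] VLMC.mΩ VLMC.hprob

/-- The event `E` depends only on the characters appended during the first `n` steps. -/
def DeterminedBy (S : VLMC v p) (n : ℕ) (E : Set S.Ω) : Prop :=
  ∀ ω ω', (∀ i, 1 ≤ i → i ≤ n → S.X i ω = S.X i ω') → ω ∈ E → ω' ∈ E

/-- The word of the characters appended during the first `n` steps. -/
def word (S : VLMC v p) (n : ℕ) (ω : S.Ω) : Fin n → Bool := fun i => S.X (i.1 + 1) ω

variable {S : VLMC v p}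

lemma measurable_word (n : ℕ) : Measurable (S.word n) :=
  measurable_pi_iff.2 fun i => S.hXmeas (i.1 + 1)

lemma eq_of_word_eq {n : ℕ} {ω ω' : S.Ω} (h : S.word n ω = S.word n ω') (i : ℕ)
    (h1 : 1 ≤ i) (hi : i ≤ n) : S.X i ω = S.X i ω' := by
  have := congrFun h ⟨i - 1, by omega⟩
  simpa [word, Nat.sub_add_cancel h1] using this

lemma cfg_eq {n : ℕ} {ω ω' : S.Ω} (h : ∀ i, 1 ≤ i → i ≤ n → S.X i ω = S.X i ω')
    (i : ℤ) (hi : i ≤ n) : S.cfg ω i = S.cfg ω' i := by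
  rw [S.hcfg, S.hcfg]
  split_ifs with h0
  · rfl
  · exact h _ (by omega) (by omega)

lemma mpos_eq {n : ℕ} {ω ω' : S.Ω} (h : ∀ i, 1 ≤ i → i ≤ n → S.X i ω = S.X i ω') :
    S.mpos ω n = S.mpos ω' n := by
  obtain ⟨a1, a2, a3⟩ := S.hmpos ω n
  obtain ⟨b1, b2, b3⟩ := S.hmpos ω' n
  rcases lt_trichotomy (S.mpos ω n) (S.mpos ω' n) with hlt | heq | hgt
  · have := a3 _ hlt b1
    rw [cfg_eq h _ b1, b2] at this
    cases this
  · exact heq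
  · have := b3 _ hgt a1
    rw [← cfg_eq h _ a1, a2] at this
    cases this

lemma hitY0_of_eq {n : ℕ} {ω ω' : S.Ω} (h : ∀ i, 1 ≤ i → i ≤ n → S.X i ω = S.X i ω')
    (hh : S.hitY0 ω n) : S.hitY0 ω' n := by
  refine ⟨mpos_eq h ▸ hh.1, fun j => ?_⟩
  rw [← cfg_eq h _ (by have := j.2; omega)]
  exact hh.2 j

lemma hitY0_congr {n m : ℕ} {ω ω' : S.Ω} (h : ∀ i, 1 ≤ i → i ≤ n → S.X i ω = S.X i ω')
    (hm : m ≤ n) : S.hitY0 ω m ↔ S.hitY0 ω' m :=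
  ⟨hitY0_of_eq fun i h1 h2 => h i h1 (h2.trans hm),
    hitY0_of_eq fun i h1 h2 => (h i h1 (h2.trans hm)).symm⟩

lemma hitY0_of_pattern {ω : S.Ω} {n : ℕ}
    (h0 : ∀ i, n + 1 ≤ i → i < n + v → S.X i ω = false) (h1 : S.X (n + v) ω = true) :
    S.hitY0 ω (n + v) := by
  have hv := S.hv
  refine ⟨?_, fun j => ?_⟩
  · obtain ⟨a1, -, a3⟩ := S.hmpos ω (n + v)
    by_contra hne
    have := a3 _ (lt_of_le_of_ne a1 hne) le_rfl
    rw [S.hcfg, if_neg (by omega), Int.toNat_natCast, h1] at this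
    cases this
  · have := j.2
    rw [S.hcfg, if_neg (by omega)]
    exact h0 _ (by omega) (by omega)

namespace DeterminedBy

lemma preimage_image_word {n : ℕ} {E : Set S.Ω} (hE : S.DeterminedBy n E) :
    S.word n ⁻¹' (S.word n '' E) = E := by
  refine Set.Subset.antisymm ?_ (Set.subset_preimage_image _ _)
  rintro ω ⟨ω', h', heq⟩
  exact hE ω' ω (eq_of_word_eq heq) h'

lemma measurableSet {n : ℕ} {E : Set S.Ω} (hE : S.DeterminedBy n E) : MeasurableSet E := by
  rw [← hE.preimage_image_word]
  exact measurable_word n (Set.toFinite _).measurableSet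

lemma inter {n : ℕ} {E F : Set S.Ω} (hE : S.DeterminedBy n E) (hF : S.DeterminedBy n F) :
    S.DeterminedBy n (E ∩ F) :=
  fun ω ω' h hω => ⟨hE ω ω' h hω.1, hF ω ω' h hω.2⟩

lemma mono {n m : ℕ} {E : Set S.Ω} (hE : S.DeterminedBy n E) (hnm : n ≤ m) :
    S.DeterminedBy m E :=
  fun ω ω' h => hE ω ω' fun i h1 h2 => h i h1 (h2.trans hnm)

end DeterminedBy

lemma measurableSet_X (n : ℕ) (c : Bool) : MeasurableSet {ω | S.X n ω = c} :=
  S.hXmeas n (measurableSet_singleton c)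

/-- A one-step lower bound on cylinders extends to all events determined by the past. -/
lemma mul_measure_le_of_cylinder {n : ℕ} {A E : Set S.Ω} {c : ENNReal}
    (hA : MeasurableSet A)
    (hcyl : ∀ ω, c * S.P (S.word n ⁻¹' {S.word n ω}) ≤ S.P (S.word n ⁻¹' {S.word n ω} ∩ A))
    (hE : S.DeterminedBy n E) : c * S.P E ≤ S.P (E ∩ A) := by
  classical
  set B : Finset (Fin n → Bool) := (Set.toFinite (S.word n '' E)).toFinset
  have hB : S.word n ⁻¹' (B : Set (Fin n → Bool)) = E := by
    simp only [B, Set.Finite.coe_toFinset, hE.preimage_image_word]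
  have key (μ : Measure S.Ω) : ∑ b ∈ B, μ (S.word n ⁻¹' {b}) = μ E := by
    rw [sum_measure_preimage_singleton _ fun b _ => measurable_word n (measurableSet_singleton b),
      hB]
  have h2 := key (S.P.restrict A)
  rw [Measure.restrict_apply' hA] at h2
  rw [← h2, ← key S.P, Finset.mul_sum]
  refine Finset.sum_le_sum fun b hb => ?_
  obtain ⟨ω, -, rfl⟩ : b ∈ S.word n '' E := by simpa [B] using hb
  rw [Measure.restrict_apply' hA]
  exact hcyl ω

lemma exists_measure_cylinder_one (n : ℕ) (ω : S.Ω) : ∃ k w,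
    S.P (S.word n ⁻¹' {S.word n ω} ∩ {ω | S.X (n + 1) ω = true})
      = ENNReal.ofReal (p k w) * S.P (S.word n ⁻¹' {S.word n ω}) := by
  refine ⟨((n : ℤ) - S.mpos ω n).toNat,
    fun j => S.cfg ω (S.mpos ω n - ((v : ℤ) - 1) + (j.1 : ℤ)), ?_⟩
  have hset : S.word n ⁻¹' {S.word n ω} = {ω' | ∀ i : Fin n, S.X (i.1 + 1) ω' = S.word n ω i} := by
    ext ω'
    exact funext_iff
  have hle := (S.hmpos ω n).1
  rw [hset]
  refine S.htrans n (S.word n ω) _ _ fun ω' hω' => ?_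
  have heq := eq_of_word_eq (S := S) (ω := ω') (ω' := ω) (funext hω')
  rw [mpos_eq heq]
  refine ⟨by omega, fun j => cfg_eq heq _ ?_⟩
  have := j.2
  omega

variable {δ1 δ2 : ℝ}

lemma CondA.mul_measure_le_one (hA : S.CondA δ1 δ2) {n : ℕ} {E : Set S.Ω}
    (hE : S.DeterminedBy n E) :
    ENNReal.ofReal δ2 * S.P E ≤ S.P (E ∩ {ω | S.X (n + 1) ω = true}) := by
  refine mul_measure_le_of_cylinder (measurableSet_X _ _) (fun ω => ?_) hE
  obtain ⟨k, w, h⟩ := exists_measure_cylinder_one n ω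
  rw [h]
  gcongr
  exact (hA.2.2.2.2 k w).1

lemma CondA.mul_measure_le_zero (hA : S.CondA δ1 δ2) {n : ℕ} {E : Set S.Ω}
    (hE : S.DeterminedBy n E) :
    ENNReal.ofReal (1 - δ1) * S.P E ≤ S.P (E ∩ {ω | S.X (n + 1) ω = false}) := by
  refine mul_measure_le_of_cylinder (measurableSet_X _ _) (fun ω => ?_) hE
  obtain ⟨k, w, h⟩ := exists_measure_cylinder_one n ω
  have hp := hA.2.2.2.2 k w
  have hδ1 := hA.2.2.2.1
  set C := S.word n ⁻¹' {S.word n ω}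
  have hsplit := measure_inter_add_sdiff (μ := S.P) C (measurableSet_X (S := S) (n + 1) true)
  have hdiff : C \ {ω | S.X (n + 1) ω = true} = C ∩ {ω | S.X (n + 1) ω = false} := by
    ext; simp
  rw [hdiff, h] at hsplit
  have hfin : ENNReal.ofReal δ1 * S.P C ≠ ⊤ :=
    ENNReal.mul_ne_top ENNReal.ofReal_ne_top (measure_ne_top _ _)
  refine (ENNReal.add_le_add_iff_left hfin).1 ?_
  rw [← add_mul, ← ENNReal.ofReal_add (by linarith [hA.2.1, hA.2.2.1]) (by linarith)]
  simp only [add_sub_cancel, ENNReal.ofReal_one, one_mul]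
  calc S.P C = _ := hsplit.symm
    _ ≤ _ := by
      gcongr
      exact hp.2

/-- The event that zeros are appended at the steps `n + 1, …, n + l`. -/
def zeros (S : VLMC v p) (n l : ℕ) : Set S.Ω :=
  {ω | ∀ i, n + 1 ≤ i → i < n + l + 1 → S.X i ω = false}

lemma determinedBy_zeros (n l : ℕ) : S.DeterminedBy (n + l) (S.zeros n l) :=
  fun _ _ h hω i h1 h2 => (h i (by omega) (by omega)).symm.trans (hω i h1 h2)

lemma CondA.pow_mul_measure_le_zeros (hA : S.CondA δ1 δ2) {n : ℕ} {E : Set S.Ω}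
    (hE : S.DeterminedBy n E) (l : ℕ) :
    ENNReal.ofReal (1 - δ1) ^ l * S.P E ≤ S.P (E ∩ S.zeros n l) := by
  induction l with
  | zero =>
    have : E ∩ S.zeros n 0 = E :=
      Set.inter_eq_left.2 fun ω _ i h1 h2 => absurd h1 (by omega)
    simp [this]
  | succ l ih =>
    calc ENNReal.ofReal (1 - δ1) ^ (l + 1) * S.P E
        = ENNReal.ofReal (1 - δ1) * (ENNReal.ofReal (1 - δ1) ^ l * S.P E) := by
          rw [pow_succ']; ring
      _ ≤ ENNReal.ofReal (1 - δ1) * S.P (E ∩ S.zeros n l) := by gcongr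
      _ ≤ S.P (E ∩ S.zeros n l ∩ {ω | S.X (n + l + 1) ω = false}) :=
          hA.mul_measure_le_zero ((hE.mono (by omega)).inter (determinedBy_zeros n l))
      _ ≤ S.P (E ∩ S.zeros n (l + 1)) := by
          refine measure_mono fun ω hω => ⟨hω.1.1, fun i h1 h2 => ?_⟩
          rcases (show i < n + l + 1 ∨ i = n + l + 1 by omega) with h | rfl
          · exact hω.1.2 i h1 h
          · exact hω.2

/-- The event that `Y` does not visit `y₀` at the times `n + 1, …, n + l`. -/
def noHit (S : VLMC v p) (n l : ℕ) : Set S.Ω := {ω | ∀ i, n < i → i ≤ n + l → ¬ S.hitY0 ω i}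

lemma determinedBy_noHit (n l : ℕ) : S.DeterminedBy (n + l) (S.noHit n l) :=
  fun _ _ h hω i h1 h2 => (hitY0_congr h h2).not.1 (hω i h1 h2)

lemma CondA.prob_mem_Ioo (hA : S.CondA δ1 δ2) :
    0 < (1 - δ1) ^ (v - 1) * δ2 ∧ (1 - δ1) ^ (v - 1) * δ2 < 1 := by
  obtain ⟨-, h2, h21, h1, -⟩ := hA
  have hp : 0 < (1 - δ1) ^ (v - 1) := pow_pos (by linarith) _
  have hp1 : (1 - δ1) ^ (v - 1) ≤ 1 := pow_le_one₀ (by linarith) (by linarith)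
  exact ⟨by positivity, by nlinarith⟩

/-- Within `v` steps, `y₀` is avoided with conditional probability at most
`1 - (1 - δ1) ^ (v - 1) * δ2`. -/
lemma CondA.measure_inter_noHit_le (hA : S.CondA δ1 δ2) {n : ℕ} {E : Set S.Ω}
    (hE : S.DeterminedBy n E) :
    S.P (E ∩ S.noHit n v) ≤ ENNReal.ofReal (1 - (1 - δ1) ^ (v - 1) * δ2) * S.P E := by
  have hv := S.hv
  obtain ⟨hq0, hq1⟩ := hA.prob_mem_Ioo (S := S)
  set q := (1 - δ1) ^ (v - 1) * δ2
  have hhit : ENNReal.ofReal q * S.P E ≤ S.P (E \ S.noHit n v) := by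
    calc ENNReal.ofReal q * S.P E
        = ENNReal.ofReal δ2 * (ENNReal.ofReal (1 - δ1) ^ (v - 1) * S.P E) := by
          have h1 : 0 ≤ 1 - δ1 := by linarith [hA.2.2.2.1]
          rw [ENNReal.ofReal_mul (pow_nonneg h1 _), ENNReal.ofReal_pow h1]
          ring
      _ ≤ ENNReal.ofReal δ2 * S.P (E ∩ S.zeros n (v - 1)) := by
          gcongr
          exact hA.pow_mul_measure_le_zeros hE _
      _ ≤ S.P (E ∩ S.zeros n (v - 1) ∩ {ω | S.X (n + (v - 1) + 1) ω = true}) :=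
          hA.mul_measure_le_one ((hE.mono (by omega)).inter (determinedBy_zeros n _))
      _ ≤ S.P (E \ S.noHit n v) := by
          refine measure_mono fun ω hω => ⟨hω.1.1, fun hno => ?_⟩
          refine hno (n + v) (by omega) le_rfl (hitY0_of_pattern (fun i h1 h2 => ?_) ?_)
          · exact hω.1.2 i h1 (by omega)
          · have := hω.2
            rwa [Set.mem_ofPred_eq, show n + (v - 1) + 1 = n + v by omega] at this
  have hsplit := measure_inter_add_sdiff (μ := S.P) E (determinedBy_noHit (S := S) n v).measurableSet
  have hfin : ENNReal.ofReal q * S.P E ≠ ⊤ :=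
    ENNReal.mul_ne_top ENNReal.ofReal_ne_top (measure_ne_top _ _)
  refine (ENNReal.add_le_add_iff_right hfin).1 ?_
  rw [← add_mul, ← ENNReal.ofReal_add (by linarith) hq0.le]
  simp only [sub_add_cancel, ENNReal.ofReal_one, one_mul]
  calc _ ≤ _ := add_le_add_right hhit _
    _ = _ := hsplit

lemma CondA.measure_inter_noHit_mul_le (hA : S.CondA δ1 δ2) {m : ℕ} {E : Set S.Ω}
    (hE : S.DeterminedBy m E) (n : ℕ) :
    S.P (E ∩ S.noHit m (n * v)) ≤
      ENNReal.ofReal (1 - (1 - δ1) ^ (v - 1) * δ2) ^ n * S.P E := by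
  induction n with
  | zero => simpa using measure_mono Set.inter_subset_left
  | succ n ih =>
    calc S.P (E ∩ S.noHit m ((n + 1) * v))
        ≤ S.P (E ∩ S.noHit m (n * v) ∩ S.noHit (m + n * v) v) := by
          refine measure_mono fun ω hω => ⟨⟨hω.1, fun i h1 h2 => ?_⟩, fun i h1 h2 => ?_⟩
          · exact hω.2 i h1 (by rw [add_mul]; omega)
          · exact hω.2 i (by omega) (by rw [add_mul]; omega)
      _ ≤ _ := hA.measure_inter_noHit_le ((hE.mono (by omega)).inter (determinedBy_noHit m _))
      _ ≤ _ := by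
          rw [pow_succ', mul_assoc]
          gcongr

/-- A geometric tail along multiples of `v` yields finite exponential moments. -/
lemma lintegral_exp_lt_top_of_tail {Ω : Type*} [MeasurableSpace Ω] {μ : Measure Ω}
    [IsProbabilityMeasure μ] {v : ℕ} (hv : 0 < v) {s c : ℝ} (hs : 0 ≤ s)
    (hsc : Real.exp (s * v) * c < 1) (τ : Ω → ℕ) (A : ℕ → Set Ω)
    (hAm : ∀ n, MeasurableSet (A n)) (hτ : ∀ n ω, n * v < τ ω → ω ∈ A n)
    (hA : ∀ n, μ (A n) ≤ ENNReal.ofReal c ^ n) :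
    ∫⁻ ω, ENNReal.ofReal (Real.exp (s * τ ω)) ∂μ < ⊤ := by
  set x := ENNReal.ofReal (Real.exp (s * v)) with hx
  have hbound : ∀ ω, ENNReal.ofReal (Real.exp (s * τ ω)) ≤
      1 + ∑' n : ℕ, (A n).indicator (fun _ => x ^ (n + 1)) ω := by
    intro ω
    rcases Nat.eq_zero_or_pos (τ ω) with h0 | hpos
    · simp [h0]
    · have h1 : (τ ω - 1) / v * v < τ ω :=
        (Nat.div_mul_le_self _ _).trans_lt (by omega)
      have h2 : τ ω ≤ ((τ ω - 1) / v + 1) * v := by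
        have := Nat.lt_div_mul_add (a := τ ω - 1) hv
        rw [add_mul]
        omega
      set n := (τ ω - 1) / v
      calc ENNReal.ofReal (Real.exp (s * τ ω)) ≤ x ^ (n + 1) := by
            rw [hx, ← ENNReal.ofReal_pow (Real.exp_pos _).le, ← Real.exp_nat_mul]
            apply ENNReal.ofReal_le_ofReal
            apply Real.exp_le_exp.2
            have h3 : (τ ω : ℝ) ≤ ((n + 1 : ℕ) : ℝ) * v := by exact_mod_cast h2
            nlinarith
        _ = (A n).indicator (fun _ => x ^ (n + 1)) ω :=
            (Set.indicator_of_mem (hτ n ω h1) (f := fun _ => x ^ (n + 1))).symm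
        _ ≤ ∑' n : ℕ, (A n).indicator (fun _ => x ^ (n + 1)) ω :=
            ENNReal.le_tsum (f := fun n => (A n).indicator (fun _ => x ^ (n + 1)) ω) n
        _ ≤ _ := le_add_self
  calc ∫⁻ ω, ENNReal.ofReal (Real.exp (s * τ ω)) ∂μ
      ≤ ∫⁻ ω, (1 + ∑' n : ℕ, (A n).indicator (fun _ => x ^ (n + 1)) ω) ∂μ :=
        lintegral_mono hbound
    _ = 1 + ∑' n : ℕ, x ^ (n + 1) * μ (A n) := by
        rw [lintegral_add_left measurable_const,
          lintegral_tsum fun n => (measurable_const.indicator (hAm n)).aemeasurable]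
        simp [lintegral_indicator_const (hAm _)]
    _ ≤ 1 + ∑' n : ℕ, x * (x * ENNReal.ofReal c) ^ n := by
        refine add_le_add_right (ENNReal.tsum_le_tsum fun n => ?_) 1
        rw [pow_succ', mul_pow, mul_assoc]
        gcongr
        exact hA n
    _ = 1 + x * (1 - x * ENNReal.ofReal c)⁻¹ := by
        rw [ENNReal.tsum_mul_left, ENNReal.tsum_geometric]
    _ < ⊤ := by
        have hlt : x * ENNReal.ofReal c < 1 := by
          rw [hx, ← ENNReal.ofReal_mul (Real.exp_pos _).le]
          exact ENNReal.ofReal_lt_one.2 hsc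
        refine ENNReal.add_lt_top.2 ⟨ENNReal.one_lt_top, ENNReal.mul_lt_top ?_ ?_⟩
        · exact ENNReal.ofReal_lt_top
        · exact ENNReal.inv_lt_top.2 (tsub_pos_of_lt hlt)

lemma not_hitY0_of_lt_T {k n : ℕ} {ω : S.Ω} (h1 : S.T k ω < n) (h2 : n < S.T (k + 1) ω) :
    ¬ S.hitY0 ω n :=
  fun h => Nat.notMem_of_lt_sInf h2 ⟨h1, h⟩

lemma T_one_eq_iff {m : ℕ} {ω : S.Ω} :
    S.T 1 ω = m + 1 ↔ S.hitY0 ω (m + 1) ∧ ω ∈ S.noHit 0 m := by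
  constructor
  · intro h
    have hmem : S.T 1 ω ∈ {n | S.T 0 ω < n ∧ S.hitY0 ω n} := by
      refine Nat.sInf_mem (Nat.nonempty_of_pos_sInf ?_)
      change 0 < S.T 1 ω
      omega
    refine ⟨h ▸ hmem.2, fun i h1 h2 => not_hitY0_of_lt_T (k := 0) h1 ?_⟩
    rw [zero_add, h]
    omega
  · rintro ⟨h1, h2⟩
    have hmem : m + 1 ∈ {n | S.T 0 ω < n ∧ S.hitY0 ω n} := ⟨Nat.succ_pos m, h1⟩
    refine le_antisymm (Nat.sInf_le hmem) ?_
    by_contra hlt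
    have hT : S.T 1 ω ∈ {n | S.T 0 ω < n ∧ S.hitY0 ω n} := Nat.sInf_mem ⟨_, hmem⟩
    exact h2 _ hT.1 (by omega) hT.2

lemma determinedBy_T_one (m : ℕ) : S.DeterminedBy (m + 1) {ω | S.T 1 ω = m + 1} := by
  intro ω ω' h hω
  obtain ⟨h1, h2⟩ := T_one_eq_iff.1 hω
  exact T_one_eq_iff.2 ⟨hitY0_of_eq h h1,
    (determinedBy_noHit 0 m).mono (by omega) ω ω' h h2⟩

lemma CondA.lintegral_exp_tau_one_lt_top (hA : S.CondA δ1 δ2) {s : ℝ} (hs : 0 ≤ s)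
    (hsc : Real.exp (s * v) * (1 - (1 - δ1) ^ (v - 1) * δ2) < 1) :
    ∫⁻ ω, ENNReal.ofReal (Real.exp (s * S.tau 1 ω)) ∂S.P < ⊤ := by
  refine lintegral_exp_lt_top_of_tail S.hv hs hsc (S.tau 1) (fun n => S.noHit 0 (n * v))
    (fun n => (determinedBy_noHit 0 _).measurableSet) (fun n ω h i h1 h2 => ?_) (fun n => ?_)
  · refine not_hitY0_of_lt_T (k := 0) h1 ?_
    have : n * v < S.T 1 ω := h
    rw [zero_add]
    omega
  · have huniv : S.DeterminedBy 0 Set.univ := fun _ _ _ _ => Set.mem_univ _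
    simpa using hA.measure_inter_noHit_mul_le huniv n

lemma CondA.lintegral_exp_tau_two_lt_top (hA : S.CondA δ1 δ2) {s : ℝ} (hs : 0 ≤ s)
    (hsc : Real.exp (s * v) * (1 - (1 - δ1) ^ (v - 1) * δ2) < 1) :
    ∫⁻ ω, ENNReal.ofReal (Real.exp (s * S.tau 2 ω)) ∂S.P < ⊤ := by
  refine lintegral_exp_lt_top_of_tail S.hv hs hsc (S.tau 2)
    (fun n => ⋃ m, {ω | S.T 1 ω = m + 1} ∩ S.noHit (m + 1) (n * v))
    (fun n => MeasurableSet.iUnion fun m => (determinedBy_T_one m).measurableSet.inter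
      (determinedBy_noHit _ _).measurableSet) (fun n ω h => ?_) (fun n => ?_)
  · have htau : n * v < S.T 2 ω - S.T 1 ω := h
    have hpos : S.T 1 ω ≠ 0 := by
      intro h0
      have : S.T 2 ω = S.T 1 ω := by
        change sInf {n | S.T 1 ω < n ∧ S.hitY0 ω n} = sInf {n | 0 < n ∧ S.hitY0 ω n}
        rw [h0]
      omega
    obtain ⟨m, hm⟩ := Nat.exists_eq_succ_of_ne_zero hpos
    refine Set.mem_iUnion.2 ⟨m, hm, fun i h1 h2 => ?_⟩
    exact not_hitY0_of_lt_T (k := 1) (by omega) (show i < S.T 2 ω by omega)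
  · calc _ ≤ ∑' m, S.P ({ω | S.T 1 ω = m + 1} ∩ S.noHit (m + 1) (n * v)) := measure_iUnion_le _
      _ ≤ ∑' m, ENNReal.ofReal (1 - (1 - δ1) ^ (v - 1) * δ2) ^ n * S.P {ω | S.T 1 ω = m + 1} :=
          ENNReal.tsum_le_tsum fun m => hA.measure_inter_noHit_mul_le (determinedBy_T_one m) n
      _ = ENNReal.ofReal (1 - (1 - δ1) ^ (v - 1) * δ2) ^ n *
            S.P (⋃ m, {ω | S.T 1 ω = m + 1}) := by
          rw [ENNReal.tsum_mul_left, measure_iUnion _ fun m =>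
            (determinedBy_T_one m).measurableSet]
          intro i j hij
          refine Set.disjoint_left.2 fun ω hi hj => hij ?_
          simp only [Set.mem_ofPred_eq] at hi hj
          omega
      _ ≤ _ := mul_le_of_le_one_right' prob_le_one

lemma zeta_le_tau (k : ℕ) (ω : S.Ω) : S.zeta k ω ≤ S.tau k ω := by
  calc S.zeta k ω ≤ ∑ n ∈ Finset.Ioc (S.T (k - 1) ω) (S.T k ω), 1 :=
        Finset.sum_le_sum fun n _ => Bool.toNat_le _
    _ = S.tau k ω := by simp [tau]

lemma lintegral_exp_norm_le (k : ℕ) {δ : ℝ} (hδ : 0 < δ) :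
    ∫⁻ ω, ENNReal.ofReal (Real.exp (δ *
        Real.sqrt ((S.tau k ω : ℝ) ^ 2 + (S.zeta k ω : ℝ) ^ 2))) ∂S.P
      ≤ ∫⁻ ω, ENNReal.ofReal (Real.exp (2 * δ * (S.tau k ω : ℝ))) ∂S.P := by
  refine lintegral_mono fun ω => ENNReal.ofReal_le_ofReal (Real.exp_le_exp.2 ?_)
  have h : (S.zeta k ω : ℝ) ≤ S.tau k ω := by exact_mod_cast zeta_le_tau k ω
  have h0 : (0 : ℝ) ≤ S.zeta k ω := Nat.cast_nonneg _
  have hsqrt : Real.sqrt ((S.tau k ω : ℝ) ^ 2 + (S.zeta k ω : ℝ) ^ 2) ≤ 2 * S.tau k ω :=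
    Real.sqrt_le_iff.2 ⟨by linarith, by nlinarith⟩
  nlinarith

lemma CondA.exp_mul_lt_one (hA : S.CondA δ1 δ2) {δ : ℝ}
    (hδ : δ < (((1 : ℝ) / v) * Real.log (1 / (1 - (1 - δ1) ^ (v - 1) * δ2))) / 2) :
    Real.exp (2 * δ * v) * (1 - (1 - δ1) ^ (v - 1) * δ2) < 1 := by
  have hv : (0 : ℝ) < v := Nat.cast_pos.2 S.hv
  obtain ⟨-, hq1⟩ := hA.prob_mem_Ioo (S := S)
  set c := 1 - (1 - δ1) ^ (v - 1) * δ2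
  have hc : 0 < c := by linarith
  have hlt : 2 * δ * v < Real.log (1 / c) := by
    have h : 2 * δ < Real.log (1 / c) / v := by
      rw [one_div_mul_eq_div] at hδ
      linarith
    exact (lt_div_iff₀ hv).1 h
  have := (Real.lt_log_iff_exp_lt (by positivity)).1 hlt
  exact (lt_div_iff₀ hc).1 this

end VLMC

namespace VLMC

/-- the Cramér condition [C₀]: under condition [A], for every
`0 < δ < ρ/2` one has `E e^{δ|ξ₁|} ≤ E e^{2δτ₁} < ∞` and `E e^{δ|ξ|} ≤ E e^{2δτ} < ∞`,
with `|ξ| = √(τ² + ζ²)` the Euclidean norm in `ℝ²` and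
`ρ = (1/v) ln (1/(1 - (1-δ1)^{v-1} δ2))`. -/
theorem statement7 {v : ℕ} {p : ℕ → (Fin (v - 1) → Bool) → ℝ} (S : VLMC v p)
    (δ1 δ2 : ℝ) (hA : S.CondA δ1 δ2)
    (δ : ℝ) (hδpos : 0 < δ) (hδ : δ < (((1 : ℝ) / v) * Real.log (1 / (1 - (1 - δ1) ^ (v - 1) * δ2))) / 2) :
    ((∫⁻ ω, ENNReal.ofReal (Real.exp (δ *
          Real.sqrt ((S.tau 1 ω : ℝ) ^ 2 + (S.zeta 1 ω : ℝ) ^ 2))) ∂S.P)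
        ≤ (∫⁻ ω, ENNReal.ofReal (Real.exp (2 * δ * (S.tau 1 ω : ℝ))) ∂S.P) ∧
      (∫⁻ ω, ENNReal.ofReal (Real.exp (2 * δ * (S.tau 1 ω : ℝ))) ∂S.P) < ⊤) ∧
    ((∫⁻ ω, ENNReal.ofReal (Real.exp (δ *
          Real.sqrt ((S.tau 2 ω : ℝ) ^ 2 + (S.zeta 2 ω : ℝ) ^ 2))) ∂S.P)
        ≤ (∫⁻ ω, ENNReal.ofReal (Real.exp (2 * δ * (S.tau 2 ω : ℝ))) ∂S.P) ∧
      (∫⁻ ω, ENNReal.ofReal (Real.exp (2 * δ * (S.tau 2 ω : ℝ))) ∂S.P) < ⊤) := by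
  have hs : 0 ≤ 2 * δ := by positivity
  have hsc := hA.exp_mul_lt_one hδ
  exact ⟨⟨lintegral_exp_norm_le 1 hδpos, hA.lintegral_exp_tau_one_lt_top hs hsc⟩,
    lintegral_exp_norm_le 2 hδpos, hA.lintegral_exp_tau_two_lt_top hs hsc⟩

end VLMC
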